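/- For all positive integers d, l, r, r', s there are positive integers f = f(d,l,r,r',s) and g = g(d,l,r,r',s) such that for every (f,g)-constellation 𝔠, one of the following holds: (a) 𝔠 has an induced subgraph isomorphic to K_{r,r} or to a proper subdivision of K_{r'}; or (b) there is a d-ample (s,l)-constellation 𝔡 with S_𝔡 ⊆ S_𝔠 and ℒ_𝔡 ⊆ ℒ_𝔠. -/

import Mathlib

open SimpleGraph

/-- Two vertex sets `X` and `Y` are *anticomplete* in `G` if they are disjoint and
there is no edge of `G` with an end in each. -/
def Anticomplete {V : Type} (G : SimpleGraph V) (X Y : Set V) : Prop :=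
  Disjoint X Y ∧ ∀ x ∈ X, ∀ y ∈ Y, ¬ G.Adj x y

/-- `G` has an induced subgraph isomorphic to `H`. -/
def HasInducedSubgraphIso {V W : Type} (G : SimpleGraph V) (H : SimpleGraph W) : Prop :=
  ∃ X : Set V, Nonempty (H ≃g G.induce X)

/-- `G` has an induced minor isomorphic to `H`, witnessed by branch sets. -/
def HasInducedMinor {V W : Type} (G : SimpleGraph V) (H : SimpleGraph W) : Prop :=
  ∃ B : W → Set V,
    (∀ w, (G.induce (B w)).Connected) ∧
    (Pairwise fun u v => Disjoint (B u) (B v)) ∧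
    (∀ u v : W, u ≠ v → (H.Adj u v ↔ ¬ Anticomplete G (B u) (B v)))

/-- The set `P` induces a path in `G`. -/
def IsPathSet {V : Type} (G : SimpleGraph V) (P : Set V) : Prop :=
  ∃ n : ℕ, Nonempty (G.induce P ≃g pathGraph (n + 1))

/-- The vertex sets of the connected components of the subgraph of `G` induced on `X`. -/
def CompsOn {V : Type} (G : SimpleGraph V) (X : Set V) : Set (Set V) :=
  {L | ∃ C : (G.induce X).ConnectedComponent, L = Subtype.val '' C.supp}

/-- The induced subgraph of `G` on `W` together with the stable set `S ⊆ W` forms a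
constellation: every component of `W \ S` is a path and every vertex of `S` has a
neighbor in every such component. -/
structure IsConstellationOn {V : Type} (G : SimpleGraph V) (W S : Set V) : Prop where
  subset : S ⊆ W
  stable : ∀ x ∈ S, ∀ y ∈ S, ¬ G.Adj x y
  comp_paths : ∀ L ∈ CompsOn G (W \ S), IsPathSet G L
  dominates : ∀ x ∈ S, ∀ L ∈ CompsOn G (W \ S), ∃ y ∈ L, G.Adj x y

/-- `p` is a route of the constellation `(W, S)` in `G`: an induced path of the induced
subgraph of `G` on `W`, with its two (distinct) ends in `S` and its interior outside `S`. -/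
structure IsRoute {V : Type} (G : SimpleGraph V) (W S : Set V) {x y : V}
    (p : G.Walk x y) : Prop where
  ne : x ≠ y
  isPath : p.IsPath
  induced : ∀ u v, u ∈ p.support → v ∈ p.support → G.Adj u v → p.toSubgraph.Adj u v
  support_mem : ∀ v ∈ p.support, v ∈ W
  fst_mem : x ∈ S
  snd_mem : y ∈ S
  interior : ∀ v ∈ p.support, v ≠ x → v ≠ y → v ∉ S

/-- The constellation `(W, S)` in `G` is `d`-ample: no route has length at most `d+1`. -/
def DAmple {V : Type} (G : SimpleGraph V) (W S : Set V) (d : ℕ) : Prop :=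
  ∀ ⦃x y : V⦄ (p : G.Walk x y), IsRoute G W S p → d + 1 < p.length

/-- The constellation `(W, S)` in `G` is interrupted with respect to some linear order
(encoded by an injective-on-`S` function `f : V → ℕ`). -/
def Interrupted {V : Type} (G : SimpleGraph V) (W S : Set V) : Prop :=
  ∃ f : V → ℕ, Set.InjOn f S ∧
    ∀ x ∈ S, ∀ y ∈ S, ∀ z ∈ S, f x < f y → f y < f z →
      ∀ (p : G.Walk x y), IsRoute G W S p → ∃ v ∈ p.support, G.Adj z v

/-- The constellation `(W, S)` in `G` is `q`-zigzagged. -/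
def Zigzagged {V : Type} (G : SimpleGraph V) (W S : Set V) (q : ℕ) : Prop :=
  ∃ f : V → ℕ, Set.InjOn f S ∧
    ∀ x ∈ S, ∀ y ∈ S, f x < f y →
      ∀ (p : G.Walk x y), IsRoute G W S p →
        {z | z ∈ S ∧ f x < f z ∧ f z < f y ∧ ¬ ∃ v ∈ p.support, G.Adj z v}.ncard < q

/-- The constellation `(W, S)` in `G` is `(qm, q, qp)`-mixed. -/
def Mixed {V : Type} (G : SimpleGraph V) (W S : Set V) (qm q qp : ℕ) : Prop :=
  ∃ f : V → ℕ, Set.InjOn f S ∧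
    ∀ x ∈ S, ∀ y ∈ S, f x < f y →
      ∀ (p : G.Walk x y), IsRoute G W S p →
        ∀ Qm Q Qp : Set V, Qm ⊆ S → Q ⊆ S → Qp ⊆ S →
          Qm.ncard = qm → Q.ncard = q → Qp.ncard = qp →
          (∀ z ∈ Qm, f z < f x) → (∀ z ∈ Q, f x < f z ∧ f z < f y) →
          (∀ z ∈ Qp, f y < f z) →
          ∃ z ∈ Qm ∪ Q ∪ Qp, ∃ v ∈ p.support, G.Adj z v

/-- The constellation `(W', S')` sits in the constellation `(W, S)` (both within `G`). -/
def SitsIn {V : Type} (G : SimpleGraph V) (W' S' W S : Set V) : Prop :=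
  W' ⊆ W ∧ S' ⊆ S ∧
  (∀ L ∈ CompsOn G (W' \ S'), ∃ M ∈ CompsOn G (W \ S), L ⊆ M) ∧
  (∀ M ∈ CompsOn G (W \ S), ∀ L₁ ∈ CompsOn G (W' \ S'), ∀ L₂ ∈ CompsOn G (W' \ S'),
      L₁ ⊆ M → L₂ ⊆ M → L₁ = L₂)

/-- A witness that `S` is a subdivision of `H`, where each edge of `H` is replaced by a
path whose length satisfies `ok`. -/
structure SubdivModel {U W : Type} (S : SimpleGraph U) (H : SimpleGraph W)
    (ok : ℕ → Prop) where
  b : W → U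
  b_inj : Function.Injective b
  path : ∀ ⦃u v : W⦄, H.Adj u v → S.Walk (b u) (b v)
  path_isPath : ∀ ⦃u v : W⦄ (h : H.Adj u v), (path h).IsPath
  path_len : ∀ ⦃u v : W⦄ (h : H.Adj u v), ok (path h).length
  path_symm : ∀ ⦃u v : W⦄ (h : H.Adj u v), path h.symm = (path h).reverse
  branch_avoid : ∀ ⦃u v : W⦄ (h : H.Adj u v) (w : W), b w ∈ (path h).support → w = u ∨ w = v
  interiors_anticomplete :
    ∀ ⦃u v u' v' : W⦄ (h : H.Adj u v) (h' : H.Adj u' v'),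
      (s(u, v) : Sym2 W) ≠ s(u', v') →
      ∀ x ∈ (path h).support, x ≠ b u → x ≠ b v →
      ∀ y ∈ (path h').support, y ≠ b u' → y ≠ b v' →
        x ≠ y ∧ ¬ S.Adj x y
  cover : ∀ x : U, (∃ w, x = b w) ∨ ∃ (u v : W) (h : H.Adj u v), x ∈ (path h).support
  edges_eq : ∀ x y : U, S.Adj x y → ∃ (u v : W) (h : H.Adj u v), (path h).toSubgraph.Adj x y

/-- `S` is a subdivision of `H` with path lengths satisfying `ok`. -/
def IsSubdivisionWith {U W : Type} (S : SimpleGraph U) (H : SimpleGraph W)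
    (ok : ℕ → Prop) : Prop :=
  Nonempty (SubdivModel S H ok)

/-- The line graph of `G`. -/
def LineGraph {V : Type} (G : SimpleGraph V) : SimpleGraph G.edgeSet :=
  SimpleGraph.fromRel (fun e f => ∃ v : V, v ∈ (e : Sym2 V) ∧ v ∈ (f : Sym2 V))

/-- The `r`-by-`r` hexagonal wall (brick wall). -/
def Wall (r : ℕ) : SimpleGraph (Fin r × Fin (2 * r)) :=
  SimpleGraph.fromRel (fun a b =>
    (a.1 = b.1 ∧ a.2.val + 1 = b.2.val) ∨
    (a.2 = b.2 ∧ a.1.val + 1 = b.1.val ∧ (a.1.val + a.2.val) % 2 = 0))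

/-- The full binary tree of radius `r`, on `2^(r+1) - 1` vertices (heap indexing). -/
def BinTree (r : ℕ) : SimpleGraph (Fin (2 ^ (r + 1) - 1)) :=
  SimpleGraph.fromRel (fun a b =>
    b.val + 1 = 2 * (a.val + 1) ∨ b.val + 1 = 2 * (a.val + 1) + 1)

/-- The leaf-extension of `H` by leaves `L` attached via `f`. -/
def leafExt {W : Type} (H : SimpleGraph W) (L : Type) (f : L → W) :
    SimpleGraph (W ⊕ L) :=
  SimpleGraph.fromRel (fun a b =>
    match a, b with
    | Sum.inl a, Sum.inl b => H.Adj a b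
    | Sum.inl a, Sum.inr x => f x = a
    | _, _ => False)

/-- `G` has treewidth at most `k` (via tree decompositions). -/
def TreewidthLE {V : Type} (G : SimpleGraph V) (k : ℕ) : Prop :=
  ∃ (ι : Type) (T : SimpleGraph ι) (bag : ι → Set V),
    T.IsTree ∧
    (∀ v, ∃ i, v ∈ bag i) ∧
    (∀ u v, G.Adj u v → ∃ i, u ∈ bag i ∧ v ∈ bag i) ∧
    (∀ v, (T.induce {i | v ∈ bag i}).Connected) ∧
    (∀ i, (bag i).ncard ≤ k + 1)

/-- `G` has pathwidth at most `k` (via path decompositions). -/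
def PathwidthLE {V : Type} (G : SimpleGraph V) (k : ℕ) : Prop :=
  ∃ (n : ℕ) (bag : Fin n → Set V),
    (∀ v, ∃ i, v ∈ bag i) ∧
    (∀ u v, G.Adj u v → ∃ i, u ∈ bag i ∧ v ∈ bag i) ∧
    (∀ (v : V) (i j k' : Fin n), i ≤ j → j ≤ k' → v ∈ bag i → v ∈ bag k' → v ∈ bag j) ∧
    (∀ i, (bag i).ncard ≤ k + 1)

/-- An induced `(s,t)`-model in `G`. -/
def IsInducedModel {V : Type} (G : SimpleGraph V) {s t : ℕ}
    (A : Fin s → Set V) (B : Fin t → Set V) : Prop :=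
  (∀ i, (G.induce (A i)).Connected) ∧
  (∀ j, (G.induce (B j)).Connected) ∧
  (∀ i j : Fin s, i ≠ j → Anticomplete G (A i) (A j)) ∧
  (∀ i j : Fin t, i ≠ j → Anticomplete G (B i) (B j)) ∧
  (∀ (i : Fin s) (j : Fin t), Disjoint (A i) (B j) ∧ ¬ Anticomplete G (A i) (B j))

/-- The `A`-contraction of a model: each `A i` is contracted to the vertex `Sum.inl i`. -/
def AContraction {V : Type} (G : SimpleGraph V) {s t : ℕ}
    (A : Fin s → Set V) (B : Fin t → Set V) :
    SimpleGraph (Fin s ⊕ (⋃ j, B j : Set V)) :=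
  SimpleGraph.fromRel (fun x y =>
    match x, y with
    | Sum.inl i, Sum.inl i' => i ≠ i' ∧ ∃ a ∈ A i, ∃ a' ∈ A i', G.Adj a a'
    | Sum.inl i, Sum.inr b => ∃ a ∈ A i, G.Adj a ↑b
    | Sum.inr b, Sum.inr b' => G.Adj ↑b ↑b'
    | _, _ => False)

/-- A linear induced model is `d`-`A`-ample if its `A`-contraction is `d`-ample. -/
def ModelAAmple {V : Type} (G : SimpleGraph V) {s t : ℕ}
    (A : Fin s → Set V) (B : Fin t → Set V) (d : ℕ) : Prop :=
  DAmple (AContraction G A B) Set.univ (Set.range Sum.inl) d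

/-- A linear induced model is `d`-ample if it is `d`-`A`-ample and `d`-`B`-ample. -/
def ModelAmple {V : Type} (G : SimpleGraph V) {s t : ℕ}
    (A : Fin s → Set V) (B : Fin t → Set V) (d : ℕ) : Prop :=
  ModelAAmple G A B d ∧ ModelAAmple G B A d

/-- The zigzag sequences. -/
def Zseq : ℕ → List ℤ
  | 0 => []
  | 1 => [1]
  | 2 => [1, 2]
  | 3 => [1, 2, 3]
  | n + 4 =>
      (Zseq (n + 3)).dropLast ++ (((Zseq (n + 2)).map (· + 1)).reverse).dropLast
        ++ (Zseq (n + 3)).map (· + 1)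

/-- Collapse each maximal run of consecutive equal entries to a single entry. -/
def collapse (l : List ℤ) : List ℤ := l.destutter (· ≠ ·)

/-- `B` is an alignment in the sequence `A`. -/
def IsAlignment (A : List ℤ) (B : Finset ℤ) : Prop :=
  (∀ b ∈ B, b ∈ A) ∧
  ∃ i j : ℕ, i ≤ j ∧ j < A.length ∧
    ∀ b ∈ B,
      (collapse (((A.take (j + 1)).drop i).filter (fun a => decide (a ∈ B)))).count b = 1

/-! ### Finite combinatorics -/

/-- A finite form of Ramsey's theorem for graphs. -/
theorem exists_ramsey_bound (a b : ℕ) :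
    ∃ n : ℕ, ∀ {α : Type} (H : SimpleGraph α) (A : Finset α), n ≤ A.card →
      (∃ B ⊆ A, B.card = a ∧ H.IsClique (B : Set α)) ∨
        ∃ B ⊆ A, B.card = b ∧ H.IsIndepSet (B : Set α) := by
  classical
  induction a generalizing b with
  | zero => exact ⟨0, fun H A _ => Or.inl ⟨∅, by simp, by simp, by simp⟩⟩
  | succ a iha =>
    induction b with
    | zero => exact ⟨0, fun H A _ => Or.inr ⟨∅, by simp, by simp, by simp⟩⟩
    | succ b ihb =>
      obtain ⟨n, hn⟩ := iha (b + 1)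
      obtain ⟨m, hm⟩ := ihb
      refine ⟨n + m + 1, fun {α} H A hA => ?_⟩
      obtain ⟨v, hv⟩ : A.Nonempty := Finset.card_pos.mp (by omega)
      have hsplit := Finset.card_filter_add_card_filter_not (s := A.erase v) (fun w => H.Adj v w)
      rw [Finset.card_erase_of_mem hv] at hsplit
      by_cases hcase : n ≤ ((A.erase v).filter (fun w => H.Adj v w)).card
      · rcases hn H _ hcase with ⟨B, hBA, hB, hcl⟩ | ⟨B, hBA, hB, hind⟩
        · refine Or.inl ⟨insert v B, ?_, ?_, ?_⟩
          · grind
          · rw [Finset.card_insert_of_notMem (by grind), hB]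
          · rw [Finset.coe_insert]
            exact hcl.insert fun w hw _ => (Finset.mem_filter.mp (hBA hw)).2
        · exact Or.inr ⟨B, by grind, hB, hind⟩
      · rcases hm H ((A.erase v).filter (fun w => ¬ H.Adj v w)) (by omega) with
          ⟨B, hBA, hB, hcl⟩ | ⟨B, hBA, hB, hind⟩
        · exact Or.inl ⟨B, by grind, hB, hcl⟩
        · refine Or.inr ⟨insert v B, ?_, ?_, ?_⟩
          · grind
          · rw [Finset.card_insert_of_notMem (by grind), hB]
          · rw [Finset.coe_insert]
            have hvB : ∀ w ∈ B, ¬ H.Adj v w := fun w hw => (Finset.mem_filter.mp (hBA hw)).2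
            exact Set.pairwise_insert.mpr
              ⟨hind, fun w hw _ => ⟨hvB w hw, fun h => hvB w hw h.symm⟩⟩

/-- If each coordinate of `φ : Fin n → α` is only allowed to hit a set of at most `K` values
determined by the other coordinates, and `n * K < |α|`, then some `φ` avoids all these sets. -/
theorem exists_forall_notMem_of_card_le {α : Type} [Fintype α] [DecidableEq α] {n K : ℕ}
    (bad : Fin n → (Fin n → α) → Finset α)
    (hbad : ∀ c φ v, bad c (Function.update φ c v) = bad c φ)
    (hcard : ∀ c φ, (bad c φ).card ≤ K) (hK : n * K < Fintype.card α) :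
    ∃ φ : Fin n → α, ∀ c, φ c ∉ bad c φ := by
  by_contra! hcon
  have hne : Nonempty α := Fintype.card_pos_iff.mp (by omega)
  set E : Fin n → Finset (Fin n → α) := fun c => Finset.univ.filter fun φ => φ c ∈ bad c φ
  have hE : ∀ c, (E c).card * Fintype.card α ≤ K * Fintype.card (Fin n → α) := by
    intro c
    have h1 : (E c ×ˢ (Finset.univ : Finset α)).card ≤
        ((Finset.univ : Finset (Fin n → α)).sigma fun φ => bad c φ).card := by
      refine Finset.card_le_card_of_injOn
        (fun q => ⟨Function.update q.1 c q.2, q.1 c⟩) ?_ ?_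
      · rintro ⟨φ, v⟩ h
        have h' : φ c ∈ bad c φ := by simpa [E] using h
        simpa [hbad] using h'
      · rintro ⟨φ, v⟩ - ⟨ψ, w⟩ - h
        simp only [Sigma.mk.injEq, heq_eq_eq] at h
        obtain ⟨h, hc⟩ := h
        have hvw : v = w := by simpa using congrFun h c
        refine Prod.ext (funext fun i => ?_) hvw
        by_cases hi : i = c
        · exact hi ▸ hc
        · simpa [hi] using congrFun h i
    rw [Finset.card_product, Finset.card_univ, Finset.card_sigma] at h1
    refine h1.trans ((Finset.sum_le_card_nsmul _ _ K fun φ _ => hcard c φ).trans ?_)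
    rw [Finset.card_univ, smul_eq_mul, mul_comm]
  have hcover : (Finset.univ : Finset (Fin n → α)) ⊆ Finset.univ.biUnion E := by
    intro φ _
    obtain ⟨c, hc⟩ := hcon φ
    simpa [E] using ⟨c, hc⟩
  have h2 := (Finset.card_le_card hcover).trans Finset.card_biUnion_le
  have h3 : Fintype.card (Fin n → α) * Fintype.card α ≤
      n * K * Fintype.card (Fin n → α) := by
    calc _ ≤ (∑ c, (E c).card) * Fintype.card α := Nat.mul_le_mul_right _ (by simpa using h2)
      _ = ∑ c, (E c).card * Fintype.card α := Finset.sum_mul _ _ _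
      _ ≤ ∑ _c : Fin n, K * Fintype.card (Fin n → α) := Finset.sum_le_sum fun c _ => hE c
      _ = _ := by simp [mul_assoc]
  have hpos : 0 < Fintype.card (Fin n → α) := Fintype.card_pos
  nlinarith

/-- A free set lemma: if every pair of points of `α` has at most `k` associated points, then a
large `α` contains `n` distinct points none of which is associated with two others. -/
theorem exists_free_injective {α : Type} [Fintype α] [DecidableEq α] {n k : ℕ}
    (A : α → α → Finset α) (hA : ∀ x y, (A x y).card ≤ k)
    (hk : n * (n + n * n * k) < Fintype.card α) :
    ∃ φ : Fin n → α, Function.Injective φ ∧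
      ∀ a b c, c ≠ a → c ≠ b → φ c ∉ A (φ a) (φ b) := by
  have key := exists_forall_notMem_of_card_le (n := n) (K := n + n * n * k)
    (fun c φ => ((Finset.univ.erase c).image φ) ∪
      ((Finset.univ.erase c) ×ˢ (Finset.univ.erase c)).biUnion
        fun q => A (φ q.1) (φ q.2)) ?_ ?_ hk
  · obtain ⟨φ, hφ⟩ := key
    refine ⟨φ, fun a b hab => ?_, fun a b c hca hcb hmem => hφ c ?_⟩
    · by_contra hne
      apply hφ b
      refine Finset.mem_union_left _ (Finset.mem_image.mpr ⟨a, by simp [hne], hab⟩)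
    · refine Finset.mem_union_right _ (Finset.mem_biUnion.mpr ⟨(a, b), ?_, hmem⟩)
      simp [hca.symm, hcb.symm]
  · intro c φ v
    congr 1
    · refine Finset.image_congr fun i hi => ?_
      simp [Finset.ne_of_mem_erase hi]
    · refine Finset.biUnion_congr rfl fun q hq => ?_
      simp only [Finset.mem_product, Finset.mem_erase] at hq
      simp [hq.1.1, hq.2.1]
  · intro c φ
    have hle : (Finset.univ.erase c).card ≤ n :=
      (Finset.card_erase_le).trans (by simp)
    refine (Finset.card_union_le _ _).trans (Nat.add_le_add (Finset.card_image_le.trans hle) ?_)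
    refine (Finset.card_biUnion_le_card_mul _ _ k fun q _ => hA _ _).trans ?_
    rw [Finset.card_product]
    gcongr

/-! ### Components of an induced subgraph -/

/-- A nonempty set is a component of `X` iff it is contained in `X`, closed under taking
neighbors in `X`, and any two of its vertices are joined by a walk inside it. -/
theorem mem_compsOn_iff {V : Type} {G : SimpleGraph V} {X L : Set V} :
    L ∈ CompsOn G X ↔ L.Nonempty ∧ L ⊆ X ∧ (∀ u ∈ L, ∀ w ∈ X, G.Adj u w → w ∈ L) ∧
      ∀ u ∈ L, ∀ w ∈ L, ∃ p : G.Walk u w, ∀ z ∈ p.support, z ∈ L := by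
  classical
  constructor
  · rintro ⟨C, rfl⟩
    refine ⟨C.nonempty_supp.image _, by rintro _ ⟨v, -, rfl⟩; exact v.2, ?_, ?_⟩
    · rintro _ ⟨u, hu, rfl⟩ w hw huw
      exact ⟨⟨w, hw⟩, C.mem_supp_of_adj_mem_supp hu huw, rfl⟩
    · rintro _ ⟨u, hu, rfl⟩ _ ⟨w, hw, rfl⟩
      rw [ConnectedComponent.mem_supp_iff] at hu hw
      obtain ⟨p⟩ := ConnectedComponent.exact (hu.trans hw.symm)
      refine ⟨p.map (Embedding.induce X).toHom, fun z hz => ?_⟩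
      replace hz := (p.support_map _) ▸ hz
      rw [List.mem_map] at hz
      obtain ⟨y, hy, rfl⟩ := hz
      refine ⟨y, ?_, rfl⟩
      rw [ConnectedComponent.mem_supp_iff, ← hu]
      exact ConnectedComponent.sound ⟨(p.takeUntil y hy).reverse⟩
  · rintro ⟨⟨v, hv⟩, hLX, hcl, hwalk⟩
    refine ⟨(G.induce X).connectedComponentMk ⟨v, hLX hv⟩, ?_⟩
    ext w
    constructor
    · intro hw
      obtain ⟨p, hp⟩ := hwalk v hv w hw
      exact ⟨⟨w, hLX hw⟩,
        ConnectedComponent.sound ⟨(p.induce X fun z hz => hLX (hp z hz)).reverse⟩, rfl⟩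
    · rintro ⟨w, hw, rfl⟩
      obtain ⟨p⟩ := ConnectedComponent.exact hw
      have hstay : ∀ {a b : X}, (G.induce X).Walk a b → (b : V) ∈ L → (a : V) ∈ L := by
        intro a b p
        induction p with
        | nil => exact id
        | cons h _ ih => exact fun hb => hcl _ (ih hb) _ (Subtype.coe_prop _) h.symm
      exact hstay p hv

theorem eq_of_mem_compsOn {V : Type} {G : SimpleGraph V} {X L M : Set V} {v : V}
    (hL : L ∈ CompsOn G X) (hM : M ∈ CompsOn G X) (hvL : v ∈ L) (hvM : v ∈ M) : L = M := by
  obtain ⟨C, rfl⟩ := hL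
  obtain ⟨D, rfl⟩ := hM
  obtain ⟨u, hu, rfl⟩ := hvL
  obtain ⟨w, hw, huw⟩ := hvM
  rw [← Subtype.ext huw] at hu
  rw [ConnectedComponent.mem_supp_iff] at hu hw
  rw [← hu, ← hw]

theorem compsOn_sUnion {V : Type} {G : SimpleGraph V} {X : Set V} {F : Set (Set V)}
    (hF : F ⊆ CompsOn G X) : CompsOn G (⋃₀ F) = F := by
  have hsub : F ⊆ CompsOn G (⋃₀ F) := by
    intro L hL
    obtain ⟨h1, -, h3, h4⟩ := mem_compsOn_iff.mp (hF hL)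
    refine mem_compsOn_iff.mpr ⟨h1, Set.subset_sUnion_of_mem hL, fun u hu w hw => h3 u hu w ?_, h4⟩
    obtain ⟨M, hM, hwM⟩ := hw
    exact (mem_compsOn_iff.mp (hF hM)).2.1 hwM
  refine Set.Subset.antisymm (fun M hM => ?_) hsub
  obtain ⟨⟨v, hv⟩, hMX, -⟩ := mem_compsOn_iff.mp hM
  obtain ⟨L, hL, hvL⟩ := hMX hv
  rwa [eq_of_mem_compsOn hM (hsub hL) hv hvL]

theorem not_adj_of_mem_compsOn {V : Type} {G : SimpleGraph V} {X L M : Set V} {u v : V}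
    (hL : L ∈ CompsOn G X) (hM : M ∈ CompsOn G X) (hne : L ≠ M) (hu : u ∈ L) (hv : v ∈ M) :
    ¬ G.Adj u v := fun h =>
  hne (eq_of_mem_compsOn hL hM
    ((mem_compsOn_iff.mp hL).2.2.1 u hu v ((mem_compsOn_iff.mp hM).2.1 hv) h) hv)

/-- If a path starts in a component of `Y` and all its vertices but the last are in `Y`, then all
its vertices but the last are in that component. -/
theorem forall_mem_of_isPath_of_mem_compsOn {V : Type} {G : SimpleGraph V} {Y L : Set V}
    (hL : L ∈ CompsOn G Y) {u y : V} (p : G.Walk u y) (hp : p.IsPath) (hu : u ∈ L)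
    (hY : ∀ v ∈ p.support, v ≠ y → v ∈ Y) : ∀ v ∈ p.support, v ≠ y → v ∈ L := by
  induction p with
  | nil => simp
  | @cons u w y h q ih =>
    rw [Walk.cons_isPath_iff] at hp
    intro v hv hvy
    rw [Walk.support_cons, List.mem_cons] at hv
    rcases hv with rfl | hv
    · exact hu
    · by_cases hwy : w = y
      · subst hwy
        rw [Walk.nil_iff_support_eq.mp (Walk.isPath_iff_nil.mp hp.1)] at hv
        simp_all
      · refine ih hp.1 ((mem_compsOn_iff.mp hL).2.2.1 u hu w (hY w (by simp) hwy) h)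
          (fun z hz => hY z (by simp [hz])) v hv hvy

/-! ### Routes -/

theorem IsRoute.reverse {V : Type} {G : SimpleGraph V} {W S : Set V} {x y : V} {p : G.Walk x y}
    (h : IsRoute G W S p) : IsRoute G W S p.reverse where
  ne := h.ne.symm
  isPath := h.isPath.reverse
  induced u v hu hv := by
    rw [Walk.toSubgraph_reverse]
    exact h.induced u v (by simpa using hu) (by simpa using hv)
  support_mem v hv := h.support_mem v (by simpa using hv)
  fst_mem := h.snd_mem
  snd_mem := h.fst_mem
  interior v hv hx hy := h.interior v (by simpa using hv) hy hx

/-- There is a route from `x` to `y` through `L` of length at most `d + 1`. -/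
def HasShortRoute {V : Type} (G : SimpleGraph V) (S L : Set V) (d : ℕ) (x y : V) : Prop :=
  ∃ p : G.Walk x y, IsRoute G (L ∪ S) S p ∧ p.length ≤ d + 1

theorem HasShortRoute.symm {V : Type} {G : SimpleGraph V} {S L : Set V} {d : ℕ} {x y : V}
    (h : HasShortRoute G S L d x y) : HasShortRoute G S L d y x := by
  obtain ⟨p, hp, hlen⟩ := h
  exact ⟨p.reverse, hp.reverse, by simpa using hlen⟩

/-- A route through a union of components runs through one of them. -/
theorem IsRoute.exists_isRoute_component {V : Type} {G : SimpleGraph V} {X S S' : Set V}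
    {F : Set (Set V)} (hF : F ⊆ CompsOn G X) (hX : Disjoint X S)
    (hstab : ∀ x ∈ S, ∀ y ∈ S, ¬ G.Adj x y) (hS' : S' ⊆ S) {x y : V} {p : G.Walk x y}
    (hp : IsRoute G (⋃₀ F ∪ S') S' p) : ∃ L ∈ F, IsRoute G (L ∪ S) S p := by
  have hmem : ∀ v ∈ p.support, v ≠ x → v ≠ y → v ∈ ⋃₀ F := fun v hv hx hy =>
    (hp.support_mem v hv).resolve_right (hp.interior v hv hx hy)
  obtain ⟨L, hLF, hL⟩ : ∃ L ∈ F, ∀ v ∈ p.support, v ≠ x → v ≠ y → v ∈ L := by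
    cases p with
    | nil => exact absurd rfl hp.ne
    | @cons _ u _ h q =>
      have hqp := (Walk.cons_isPath_iff h q).mp hp.isPath
      have huy : u ≠ y := by
        rintro rfl
        exact hstab _ (hS' hp.fst_mem) _ (hS' hp.snd_mem) h
      obtain ⟨L, hLF, huL⟩ := hmem u (by simp) h.ne.symm huy
      refine ⟨L, hLF, fun v hv hvx hvy => ?_⟩
      refine forall_mem_of_isPath_of_mem_compsOn ((compsOn_sUnion hF).symm.subset hLF) q hqp.1 huL
        (fun w hw hwy => hmem w (by simp [hw]) ?_ hwy) v (by simpa [hvx] using hv) hvy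
      rintro rfl
      exact hqp.2 hw
  have hLX := (mem_compsOn_iff.mp (hF hLF)).2.1
  refine ⟨L, hLF, hp.ne, hp.isPath, hp.induced, fun v hv => ?_, hS' hp.fst_mem, hS' hp.snd_mem,
    fun v hv hx hy hvS => Set.disjoint_left.mp hX (hLX (hL v hv hx hy)) hvS⟩
  by_cases hx : v = x
  · exact Or.inr (hx ▸ hS' hp.fst_mem)
  by_cases hy : v = y
  · exact Or.inr (hy ▸ hS' hp.snd_mem)
  exact Or.inl (hL v hv hx hy)

/-! ### The induced subgraphs -/

theorem hasInducedSubgraphIso_completeBipartiteGraph {V : Type} {G : SimpleGraph V} {r : ℕ}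
    (a b : Fin r → V) (ha : Function.Injective a) (hb : Function.Injective b)
    (haa : ∀ i j, ¬ G.Adj (a i) (a j)) (hbb : ∀ i j, ¬ G.Adj (b i) (b j))
    (hab : ∀ i j, G.Adj (a i) (b j)) :
    HasInducedSubgraphIso G (completeBipartiteGraph (Fin r) (Fin r)) := by
  let φ : completeBipartiteGraph (Fin r) (Fin r) ↪g G :=
    { toFun := Sum.elim a b
      inj' := ha.sumElim hb fun i j => (hab i j).ne
      map_rel_iff' := by
        rintro (i | i) (j | j) <;> simp [haa, hbb, hab, (hab _ _).symm] }
  exact ⟨Set.range φ, ⟨φ.isoInduceRange⟩⟩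

/-- A system of paths in `G`, one for each edge of `H`, whose union induces no further edges
yields a subdivision of `H` as an induced subgraph. -/
theorem isSubdivisionWith_induce {V W : Type} {G : SimpleGraph V} {H : SimpleGraph W}
    {ok : ℕ → Prop} (b : W → V) (hb : Function.Injective b)
    (path : ∀ ⦃u v : W⦄, H.Adj u v → G.Walk (b u) (b v))
    (path_isPath : ∀ ⦃u v : W⦄ (h : H.Adj u v), (path h).IsPath)
    (path_len : ∀ ⦃u v : W⦄ (h : H.Adj u v), ok (path h).length)
    (path_symm : ∀ ⦃u v : W⦄ (h : H.Adj u v), path h.symm = (path h).reverse)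
    (branch_avoid : ∀ ⦃u v : W⦄ (h : H.Adj u v) (w : W),
      b w ∈ (path h).support → w = u ∨ w = v)
    (interiors : ∀ ⦃u v u' v' : W⦄ (h : H.Adj u v) (h' : H.Adj u' v'),
      (s(u, v) : Sym2 W) ≠ s(u', v') →
      ∀ x ∈ (path h).support, x ≠ b u → x ≠ b v →
      ∀ y ∈ (path h').support, y ≠ b u' → y ≠ b v' → x ≠ y ∧ ¬ G.Adj x y)
    (induced : ∀ ⦃u v : W⦄ (h : H.Adj u v), ∀ x ∈ (path h).support, ∀ y ∈ (path h).support,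
      G.Adj x y → (path h).toSubgraph.Adj x y)
    (branch_branch : ∀ w w', ¬ G.Adj (b w) (b w'))
    (branch_interior : ∀ ⦃u v : W⦄ (h : H.Adj u v) (w : W), w ≠ u → w ≠ v →
      ∀ x ∈ (path h).support, ¬ G.Adj (b w) x) :
    ∃ X : Set V, IsSubdivisionWith (G.induce X) H ok := by
  set X : Set V := {x | (∃ w, x = b w) ∨ ∃ (u v : W) (h : H.Adj u v), x ∈ (path h).support}
  have hbX : ∀ w, b w ∈ X := fun w => Or.inl ⟨w, rfl⟩
  have hpX : ∀ ⦃u v : W⦄ (h : H.Adj u v), ∀ x ∈ (path h).support, x ∈ X :=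
    fun u v h x hx => Or.inr ⟨u, v, h, hx⟩
  let Q : ∀ ⦃u v : W⦄, H.Adj u v → (G.induce X).Walk ⟨b u, hbX u⟩ ⟨b v, hbX v⟩ :=
    fun u v h => (path h).induce X (hpX h)
  have hQ : ∀ ⦃u v : W⦄ (h : H.Adj u v),
      (Q h).map (Embedding.induce X).toHom = path h := fun u v h => Walk.map_induce _ _
  have hQs : ∀ ⦃u v : W⦄ (h : H.Adj u v) (x : X),
      x ∈ (Q h).support ↔ (x : V) ∈ (path h).support :=
    fun u v h x => by simp [Q, Walk.support_induce]
  have hQe : ∀ ⦃u v : W⦄ (h : H.Adj u v) (x y : X), (path h).toSubgraph.Adj x y →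
      (Q h).toSubgraph.Adj x y := by
    intro u v h x y hxy
    rw [← Subgraph.mem_edgeSet, Walk.mem_edges_toSubgraph] at hxy ⊢
    rw [← hQ h] at hxy
    replace hxy := ((Q h).edges_map _) ▸ hxy
    obtain ⟨e, he, hexy⟩ := List.mem_map.mp hxy
    have : e = s(x, y) := Sym2.map.injective Subtype.val_injective hexy
    exact this ▸ he
  refine ⟨X, ⟨{
    b := fun w => ⟨b w, hbX w⟩
    b_inj := fun u v h => hb (congrArg Subtype.val h)
    path := Q
    path_isPath := fun u v h => ?_
    path_len := fun u v h => ?_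
    path_symm := fun u v h => ?_
    branch_avoid := fun u v h w hw => branch_avoid h w ((hQs h _).mp hw)
    interiors_anticomplete := ?_
    cover := ?_
    edges_eq := ?_ }⟩⟩
  · apply Walk.IsPath.of_map (f := (Embedding.induce X).toHom)
    rw [hQ]
    exact path_isPath h
  · have := congrArg Walk.length (hQ h)
    rw [Walk.length_map] at this
    exact this ▸ path_len h
  · apply Walk.map_injective_of_injective (f := (Embedding.induce X).toHom)
      Subtype.val_injective
    rw [hQ, ← Walk.reverse_map, hQ]
    exact path_symm h
  · intro u v u' v' h h' hne x hx hxu hxv y hy hyu hyv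
    have := interiors h h' hne x ((hQs h x).mp hx) (fun e => hxu (Subtype.ext e))
      (fun e => hxv (Subtype.ext e)) y ((hQs h' y).mp hy) (fun e => hyu (Subtype.ext e))
      (fun e => hyv (Subtype.ext e))
    exact ⟨fun e => this.1 (congrArg Subtype.val e), this.2⟩
  · rintro ⟨x, ⟨w, rfl⟩ | ⟨u, v, h, hx⟩⟩
    · exact Or.inl ⟨w, rfl⟩
    · exact Or.inr ⟨u, v, h, (hQs h _).mpr hx⟩
  · have hbr : ∀ (w : W) (y : V), y ∈ X → G.Adj (b w) y →
        ∃ (u v : W) (h : H.Adj u v), (path h).toSubgraph.Adj (b w) y := by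
      rintro w y (⟨w', rfl⟩ | ⟨u, v, h, hy⟩) hadj
      · exact absurd hadj (branch_branch w w')
      · refine ⟨u, v, h, induced h _ ?_ _ hy hadj⟩
        by_cases hu : w = u
        · subst hu
          exact Walk.start_mem_support _
        by_cases hv : w = v
        · subst hv
          exact Walk.end_mem_support _
        exact absurd hadj (branch_interior h w hu hv y hy)
    suffices hG : ∀ x ∈ X, ∀ y ∈ X, G.Adj x y →
        ∃ (u v : W) (h : H.Adj u v), (path h).toSubgraph.Adj x y by
      intro x y hxy
      obtain ⟨u, v, h, hadj⟩ := hG x x.2 y y.2 hxy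
      exact ⟨u, v, h, hQe h x y hadj⟩
    intro x hx y hy hxy
    by_cases hxb : ∃ w, x = b w
    · obtain ⟨w, rfl⟩ := hxb
      exact hbr w y hy hxy
    by_cases hyb : ∃ w, y = b w
    · obtain ⟨w, rfl⟩ := hyb
      obtain ⟨u, v, h, hadj⟩ := hbr w x hx hxy.symm
      exact ⟨u, v, h, hadj.symm⟩
    obtain ⟨u, v, h, hxp⟩ := hx.resolve_left hxb
    obtain ⟨u', v', h', hyp⟩ := hy.resolve_left hyb
    by_cases he : (s(u, v) : Sym2 W) = s(u', v')
    · refine ⟨u, v, h, induced h x hxp y ?_ hxy⟩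
      rcases Sym2.eq_iff.mp he with ⟨rfl, rfl⟩ | ⟨rfl, rfl⟩
      · exact hyp
      · rw [path_symm h] at hyp
        simpa using hyp
    · exact absurd hxy (interiors h h' he x hxp (fun e => hxb ⟨_, e⟩) (fun e => hxb ⟨_, e⟩)
        y hyp (fun e => hyb ⟨_, e⟩) (fun e => hyb ⟨_, e⟩)).2

/-- Routes between the members of a subset of `S`, through distinct components, with no member
of that subset having a neighbor on a route of which it is not an end, form a proper subdivision
of a complete graph. -/
theorem exists_isSubdivisionWith_of_routes {V W : Type} {G : SimpleGraph V} {X S : Set V}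
    (hstab : ∀ x ∈ S, ∀ y ∈ S, ¬ G.Adj x y)
    (b : W → V) (hb : Function.Injective b) (hbS : ∀ w, b w ∈ S)
    (L : Sym2 W → Set V) (hLinj : Function.Injective L) (hL : ∀ e, L e ∈ CompsOn G X)
    (path : ∀ ⦃u v : W⦄, u ≠ v → G.Walk (b u) (b v))
    (path_symm : ∀ ⦃u v : W⦄ (h : u ≠ v), path h.symm = (path h).reverse)
    (hroute : ∀ ⦃u v : W⦄ (h : u ≠ v), IsRoute G (L s(u, v) ∪ S) S (path h))
    (hfree : ∀ ⦃u v : W⦄ (h : u ≠ v) (w : W), w ≠ u → w ≠ v →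
      ∀ x ∈ (path h).support, ¬ G.Adj (b w) x) :
    ∃ Y : Set V, IsSubdivisionWith (G.induce Y) (⊤ : SimpleGraph W) (fun n => 2 ≤ n) := by
  have hint : ∀ ⦃u v : W⦄ (h : u ≠ v), ∀ x ∈ (path h).support, x ≠ b u → x ≠ b v →
      x ∈ L s(u, v) := fun u v h x hx hu hv =>
    ((hroute h).support_mem x hx).resolve_right ((hroute h).interior x hx hu hv)
  refine isSubdivisionWith_induce (H := (⊤ : SimpleGraph W)) b hb (fun u v h => path h.ne)
    (fun u v h => (hroute h.ne).isPath) (fun u v h => ?_) (fun u v h => path_symm h.ne)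
    (fun u v h w hw => ?_) (fun u v u' v' h h' hne x hx hxu hxv y hy hyu hyv => ?_)
    (fun u v h x hx y hy => (hroute h.ne).induced x y hx hy)
    (fun w w' => hstab _ (hbS w) _ (hbS w')) (fun u v h w hu hv => hfree h.ne w hu hv)
  · by_contra! hlt
    have hlt' : (path h.ne).length = 0 ∨ (path h.ne).length = 1 := by omega
    rcases hlt' with h0 | h1
    · exact h.ne (hb (Walk.eq_of_length_eq_zero h0))
    · exact hstab _ (hbS u) _ (hbS v) (Walk.adj_of_length_eq_one h1)
  · by_contra! hne
    exact (hroute h.ne).interior _ hw (hb.ne hne.1) (hb.ne hne.2) (hbS w)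
  · have hxL := hint h.ne x hx hxu hxv
    have hyL := hint h'.ne y hy hyu hyv
    refine ⟨?_, not_adj_of_mem_compsOn (hL _) (hL _) (hLinj.ne hne) hxL hyL⟩
    rintro rfl
    exact hne (hLinj (eq_of_mem_compsOn (hL _) (hL _) hxL hyL))

theorem exists_embedding_fiber {α β ι : Type} [Finite α] [Finite β] [Finite ι] [Nonempty β]
    (F : α → β) (h : Nat.card β * Nat.card ι ≤ Nat.card α) :
    ∃ (y : β) (φ : ι ↪ α), ∀ i, F (φ i) = y := by
  classical
  have := Fintype.ofFinite α
  have := Fintype.ofFinite β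
  have := Fintype.ofFinite ι
  simp only [Nat.card_eq_fintype_card] at h
  obtain ⟨y, hy⟩ := Fintype.exists_le_card_fiber_of_mul_le_card F h
  rw [← Fintype.card_subtype] at hy
  obtain ⟨φ⟩ := Function.Embedding.nonempty_of_card_le hy
  exact ⟨y, φ.trans (Function.Embedding.subtype _), fun i => (φ i).2⟩

/-! ### The dichotomy for paths with a common pattern -/

/-- If all members of a large family of components have the same pairs of ends of short routes
and the same sets of vertices of `S` with a common neighbor in the component, then one of the
desired outcomes occurs. -/
theorem exists_of_common_pattern {V : Type} {G : SimpleGraph V} {X S : Set V} {d l r r' s f : ℕ}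
    (hX : Disjoint X S) (hstab : ∀ x ∈ S, ∀ y ∈ S, ¬ G.Adj x y)
    (e : Fin f → V) (he : Function.Injective e) (heS : ∀ i, e i ∈ S)
    (hram : ∀ H : SimpleGraph (Fin f),
      (∃ B : Finset (Fin f), B.card = r' * (r' + r' * r' * ((d + 2) * r)) + 1 ∧
        H.IsClique (B : Set (Fin f))) ∨
      ∃ B : Finset (Fin f), B.card = s ∧ H.IsIndepSet (B : Set (Fin f)))
    (L : Sym2 (Fin f) ⊕ Fin l ⊕ Fin r → Set V) (hLinj : Function.Injective L)
    (hL : ∀ t, L t ∈ CompsOn G X) (H : SimpleGraph (Fin f)) (P : Set (Finset (Fin f)))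
    (hH : ∀ t i j, H.Adj i j ↔ i ≠ j ∧ HasShortRoute G S (L t) d (e i) (e j))
    (hP : ∀ t Z, Z ∈ P ↔ ∃ v ∈ L t, ∀ i ∈ Z, G.Adj (e i) v) :
    (HasInducedSubgraphIso G (completeBipartiteGraph (Fin r) (Fin r)) ∨
      ∃ Y : Set V,
        IsSubdivisionWith (G.induce Y) (⊤ : SimpleGraph (Fin r')) (fun n => 2 ≤ n)) ∨
    ∃ S' ⊆ S, ∃ F ⊆ CompsOn G X, S'.ncard = s ∧ F.ncard = l ∧ DAmple G (⋃₀ F ∪ S') S' d := by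
  classical
  by_cases hheavy : ∃ Z ∈ P, Z.card = r
  · obtain ⟨Z, hZ, hZr⟩ := hheavy
    choose v hvL hv using fun j : Fin r => (hP (Sum.inr (Sum.inr j)) Z).mp hZ
    let z : Fin r ≃ Z := (Z.equivFinOfCardEq hZr).symm
    refine Or.inl (Or.inl (hasInducedSubgraphIso_completeBipartiteGraph (fun i => e (z i)) v
      (fun i j h => z.injective (Subtype.ext (he h))) (fun i j h => ?_)
      (fun i j => hstab _ (heS _) _ (heS _)) (fun i j h => ?_)
      (fun i j => hv j _ (z i).2)))
    · have := hLinj (eq_of_mem_compsOn (hL _) (hL _) (hvL i) (h ▸ hvL j))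
      simpa using this
    · by_cases hij : i = j
      · exact (hij ▸ h).ne rfl
      · exact not_adj_of_mem_compsOn (hL _) (hL _) (hLinj.ne (by simpa using hij))
          (hvL i) (hvL j) h
  have hlight : ∀ t, ∀ v ∈ L t ∪ S, (Finset.univ.filter fun i => G.Adj (e i) v).card ≤ r := by
    rintro t v (hv | hv)
    · by_contra! hlt
      obtain ⟨Z, hZ, hZr⟩ := Finset.exists_subset_card_eq hlt.le
      exact hheavy ⟨Z, (hP t Z).mpr ⟨v, hv, fun i hi => by simpa using hZ hi⟩, hZr⟩
    · rw [Finset.filter_false_of_mem fun i _ => hstab _ (heS i) _ hv]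
      simp
  rcases hram H with ⟨B, hB, hcl⟩ | ⟨B, hB, hind⟩
  · refine Or.inl (Or.inr ?_)
    choose R hR hRlen using fun i j (h : H.Adj i j) => ((hH (Sum.inl s(i, j)) i j).mp h).2
    let Q : ∀ i j, H.Adj i j → G.Walk (e i) (e j) := fun i j h =>
      if i < j then R i j h else (R j i h.symm).reverse
    have hQ : ∀ i j (h : H.Adj i j), IsRoute G (L (Sum.inl s(i, j)) ∪ S) S (Q i j h) := by
      intro i j h
      by_cases hij : i < j
      · simpa [Q, hij] using hR i j h
      · simpa [Q, hij, Sym2.eq_swap] using (hR j i h.symm).reverse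
    have hQlen : ∀ i j (h : H.Adj i j), (Q i j h).length ≤ d + 1 := by
      intro i j h
      by_cases hij : i < j
      · simpa [Q, hij] using hRlen i j h
      · simpa [Q, hij] using hRlen j i h.symm
    have hQsymm : ∀ i j (h : H.Adj i j), Q j i h.symm = (Q i j h).reverse := by
      intro i j h
      rcases lt_or_gt_of_ne h.ne with hij | hij <;> simp [Q, hij, hij.not_gt]
    let A : Fin f → Fin f → Finset (Fin f) := fun i j =>
      if h : H.Adj i j then
        (Q i j h).support.toFinset.biUnion fun v => Finset.univ.filter fun c => G.Adj (e c) v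
      else ∅
    have hA : ∀ i j, (A i j).card ≤ (d + 2) * r := by
      intro i j
      by_cases h : H.Adj i j
      · simp only [A, h, dite_true]
        refine (Finset.card_biUnion_le_card_mul _ _ r fun v hv =>
          hlight _ v ((hQ i j h).support_mem v (by simpa using hv))).trans ?_
        gcongr
        refine (List.toFinset_card_le _).trans ?_
        rw [Walk.length_support]
        exact Nat.succ_le_succ (hQlen i j h)
      · simp [A, h]
    obtain ⟨φ, hφ, hfree⟩ := exists_free_injective (α := B) (n := r') (k := (d + 2) * r)
      (fun x y => (A x y).subtype (· ∈ B))
      (fun x y => by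
        rw [Finset.card_subtype]
        exact (Finset.card_filter_le _ _).trans (hA x y))
      (by rw [Fintype.card_coe, hB]; exact Nat.lt_succ_self _)
    have hφ' : Function.Injective fun i => (φ i : Fin f) := Subtype.val_injective.comp hφ
    have hadj : ∀ ⦃u v⦄, u ≠ v → H.Adj (φ u) (φ v) := fun u v h =>
      hcl (φ u).2 (φ v).2 (hφ'.ne h)
    refine exists_isSubdivisionWith_of_routes (W := Fin r') hstab (fun i => e (φ i)) (he.comp hφ')
      (fun i => heS _) (fun p => L (Sum.inl (p.map fun i => (φ i : Fin f))))
      (hLinj.comp (Sum.inl_injective.comp (Sym2.map.injective hφ'))) (fun p => hL _)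
      (fun u v h => Q (φ u) (φ v) (hadj h)) (fun u v h => hQsymm _ _ _)
      (fun u v h => hQ _ _ _) (fun u v h w hu hv x hx hwx => hfree u v w hu hv ?_)
    rw [Finset.mem_subtype]
    simp only [A, hadj h, dite_true, Finset.mem_biUnion]
    exact ⟨x, by simpa using hx, by simpa using hwx⟩
  · refine Or.inr ⟨e '' B, ?_, Set.range fun t : Fin l => L (Sum.inr (Sum.inl t)), ?_, ?_, ?_, ?_⟩
    · rintro _ ⟨i, -, rfl⟩
      exact heS i
    · rintro _ ⟨t, rfl⟩
      exact hL _
    · rw [Set.ncard_image_of_injective _ he, Set.ncard_coe_finset, hB]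
    · have hinj : Function.Injective fun t : Fin l => L (Sum.inr (Sum.inl t)) :=
        hLinj.comp (Sum.inr_injective.comp Sum.inl_injective)
      rw [← Set.image_univ, Set.ncard_image_of_injective _ hinj, Set.ncard_univ]
      simp
    · intro x y p hp
      by_contra! hlen
      obtain ⟨_, ⟨t, rfl⟩, hroute⟩ := hp.exists_isRoute_component
        (by rintro _ ⟨t, rfl⟩; exact hL _) hX hstab
        (by rintro _ ⟨i, -, rfl⟩; exact heS i)
      obtain ⟨i, hi, rfl⟩ := hp.fst_mem
      obtain ⟨j, hj, rfl⟩ := hp.snd_mem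
      have hij : i ≠ j := fun h => hp.ne (congrArg e h)
      exact hind hi hj hij ((hH _ i j).mpr ⟨hij, p, hroute, hlen⟩)

/-- Lemma 4.1: for all positive `d, l, r, r', s` there are `f, g` such
that every `(f,g)`-constellation contains `K_{r,r}` or a proper subdivision of `K_{r'}`
as an induced subgraph, or there is a `d`-ample `(s,l)`-constellation `𝔡` with
`S_𝔡 ⊆ S_𝔠` and `ℒ_𝔡 ⊆ ℒ_𝔠`. -/
theorem stmt7 (d l r r' s : ℕ)
    (hd : 0 < d) (hl : 0 < l) (hr : 0 < r) (hr' : 0 < r') (hs : 0 < s) :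
    ∃ f g : ℕ, 0 < f ∧ 0 < g ∧
      ∀ (V : Type) [Fintype V] (G : SimpleGraph V) (S : Set V),
        IsConstellationOn G Set.univ S →
        S.ncard = f → (CompsOn G (Set.univ \ S)).ncard = g →
          (HasInducedSubgraphIso G (completeBipartiteGraph (Fin r) (Fin r)) ∨
            ∃ X : Set V,
              IsSubdivisionWith (G.induce X) (⊤ : SimpleGraph (Fin r')) (fun n => 2 ≤ n)) ∨
          (∃ W' S' : Set V, IsConstellationOn G W' S' ∧ S' ⊆ S ∧
              CompsOn G (W' \ S') ⊆ CompsOn G (Set.univ \ S) ∧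
              DAmple G W' S' d ∧
              S'.ncard = s ∧ (CompsOn G (W' \ S')).ncard = l) := by
  classical
  obtain ⟨n, hn⟩ := exists_ramsey_bound (r' * (r' + r' * r' * ((d + 2) * r)) + 1) s
  have : Nonempty (Fin l) := ⟨⟨0, hl⟩⟩
  refine ⟨n + 1, Nat.card (SimpleGraph (Fin (n + 1)) × Set (Finset (Fin (n + 1)))) *
    Nat.card (Sym2 (Fin (n + 1)) ⊕ Fin l ⊕ Fin r), Nat.succ_pos n,
    Nat.mul_pos Nat.card_pos Nat.card_pos, fun V _ G S hc hS hcomps => ?_⟩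
  have : Finite S := Set.toFinite S
  let e : Fin (n + 1) ≃ S :=
    (Finite.equivFinOfCardEq ((Nat.card_coe_set_eq S).trans hS)).symm
  have hX : Disjoint (Set.univ \ S) S := Set.disjoint_sdiff_left
  obtain ⟨⟨H, P⟩, L, hL⟩ := exists_embedding_fiber (ι := Sym2 (Fin (n + 1)) ⊕ Fin l ⊕ Fin r)
    (fun M : CompsOn G (Set.univ \ S) =>
      ((⟨fun i j => i ≠ j ∧ HasShortRoute G S M d (e i) (e j),
          ⟨fun _ _ h => ⟨h.1.symm, h.2.symm⟩⟩, ⟨fun _ h => h.1 rfl⟩⟩ :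
          SimpleGraph (Fin (n + 1))),
        {Z : Finset (Fin (n + 1)) | ∃ v ∈ (M : Set V), ∀ i ∈ Z, G.Adj (e i) v}))
    (by rw [Nat.card_coe_set_eq, hcomps])
  refine (exists_of_common_pattern (l := l) (s := s) (d := d) (r' := r') hX hc.stable
    (fun i => (e i : V)) (Subtype.val_injective.comp e.injective) (fun i => (e i).2)
    (fun H => ?_) (fun t => (L t : Set V)) (Subtype.val_injective.comp L.injective)
    (fun t => (L t).2) H P (fun t i j => ?_) (fun t Z => ?_)).imp_right ?_
  · rcases hn H Finset.univ (by simp) with ⟨B, -, h⟩ | ⟨B, -, h⟩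
    · exact Or.inl ⟨B, h⟩
    · exact Or.inr ⟨B, h⟩
  · exact (congrArg (fun q => q.1.Adj i j) (hL t)).symm.to_iff
  · exact (congrArg (fun q => Z ∈ q.2) (hL t)).symm.to_iff
  · rintro ⟨S', hS', F, hF, hS's, hFl, hample⟩
    have hFS : Disjoint (⋃₀ F) S' :=
      hX.mono (Set.sUnion_subset fun M hM => (mem_compsOn_iff.mp (hF hM)).2.1) hS'
    have hdiff : (⋃₀ F ∪ S') \ S' = ⋃₀ F := by
      rw [Set.union_sdiff_right, hFS.sdiff_eq_left]
    have hcF : CompsOn G ((⋃₀ F ∪ S') \ S') = F := by rw [hdiff, compsOn_sUnion hF]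
    refine ⟨⋃₀ F ∪ S', S', ⟨Set.subset_union_right,
      fun x hx y hy => hc.stable x (hS' hx) y (hS' hy),
      fun M hM => hc.comp_paths M (hF (hcF.subset hM)),
      fun x hx M hM => hc.dominates x (hS' hx) M (hF (hcF.subset hM))⟩, hS', hcF.symm ▸ hF, hample,
      hS's, hcF.symm ▸ hFl⟩
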